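/- Let n ≥ 1, 0 ≤ δ < 1 and a ∈ S^{-n}_{0,δ}. There is a constant C such that for every 0 < l < 1, every positive integer j, every x_0 ∈ ℝⁿ, every Schwartz function u, and all x, z in the cube Q(x_0, l): ∫_{ℝⁿ} |u(y)| |K_j(x,y) − K_j(z,y)| dy ≤ C 2^j l Mu(x_0). -/

import Mathlib

open MeasureTheory Real
open scoped ENNReal NNReal InnerProductSpace BigOperators

noncomputable section

/-- `ℝⁿ` with its Euclidean structure. -/
abbrev Rn (n : ℕ) : Type := EuclideanSpace ℝ (Fin n)

/-- The Fourier transform `û(ξ) = ∫ e^{-i⟨x,ξ⟩} u(x) dx`. -/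
def ft {n : ℕ} (u : Rn n → ℂ) (ξ : Rn n) : ℂ :=
  ∫ x : Rn n, Complex.exp (-(Complex.I * ((⟪x, ξ⟫_ℝ : ℝ) : ℂ))) * u x

/-- The pseudo-differential operator `T_a u(x) = ∫ e^{i⟨x,ξ⟩} a(x,ξ) û(ξ) dξ`. -/
def pdo {n : ℕ} (a : Rn n → Rn n → ℂ) (u : Rn n → ℂ) (x : Rn n) : ℂ :=
  ∫ ξ : Rn n, Complex.exp (Complex.I * ((⟪x, ξ⟫_ℝ : ℝ) : ℂ)) * a x ξ * ft u ξ

/-- The dual operator `T_a^* u(x) = ∫∫ e^{i⟨x-y,ξ⟩} a(y,ξ) dξ u(y) dy`. -/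
def pdoDual {n : ℕ} (a : Rn n → Rn n → ℂ) (u : Rn n → ℂ) (x : Rn n) : ℂ :=
  ∫ y : Rn n,
    (∫ ξ : Rn n, Complex.exp (Complex.I * ((⟪x - y, ξ⟫_ℝ : ℝ) : ℂ)) * a y ξ) * u y

/-- The Hörmander symbol class `S^m_{ϱ,δ}`: `a` is smooth and
`|∂^β_x ∂^α_ξ a(x,ξ)| ≤ C_{α,β} (1+|ξ|²)^{(m-ϱ|α|+δ|β|)/2}`. -/
def HormClass {n : ℕ} (m ϱ δ : ℝ) (a : Rn n → Rn n → ℂ) : Prop :=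
  ContDiff ℝ (⊤ : ℕ∞) (Function.uncurry a) ∧
  ∀ k l : ℕ, ∃ C : ℝ, 0 < C ∧ ∀ x ξ : Rn n,
    ‖iteratedFDeriv ℝ l (fun y : Rn n => iteratedFDeriv ℝ k (fun η : Rn n => a y η) ξ) x‖ ≤
      C * (1 + ‖ξ‖ ^ 2) ^ ((m - ϱ * k + δ * l) / 2)

/-- The rough Hörmander class `L^∞S^m_ϱ`: `a(x,ξ)` is smooth in `ξ`, bounded measurable in `x`,
and `‖∂^α_ξ a(·,ξ)‖_{L^∞} ≤ C_α (1+|ξ|²)^{(m-ϱ|α|)/2}`. -/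
def RoughClass {n : ℕ} (m ϱ : ℝ) (a : Rn n → Rn n → ℂ) : Prop :=
  (∀ x : Rn n, ContDiff ℝ (⊤ : ℕ∞) (a x)) ∧
  (∀ ξ : Rn n, Measurable fun x : Rn n => a x ξ) ∧
  ∀ k : ℕ, ∃ C : ℝ, 0 < C ∧ ∀ ξ : Rn n, ∀ᵐ x : Rn n ∂volume,
    ‖iteratedFDeriv ℝ k (a x) ξ‖ ≤ C * (1 + ‖ξ‖ ^ 2) ^ ((m - ϱ * k) / 2)

/-- The axis-parallel cube centered at `x₀` with side length `l`. -/
def cube {n : ℕ} (x₀ : Rn n) (l : ℝ) : Set (Rn n) :=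
  {y | ∀ i, |y i - x₀ i| ≤ l / 2}

/-- The Hardy–Littlewood maximal function over axis-parallel cubes. -/
def mHL {n : ℕ} {E : Type*} [NormedAddCommGroup E] (u : Rn n → E) (x : Rn n) : ℝ≥0∞ :=
  ⨆ (x₀ : Rn n) (l : ℝ) (_ : 0 < l) (_ : x ∈ cube x₀ l),
    (∫⁻ y in cube x₀ l, (‖u y‖₊ : ℝ≥0∞)) / ENNReal.ofReal (l ^ n)

/-- The Fefferman–Stein sharp maximal function over axis-parallel cubes. -/
def mSharp {n : ℕ} (u : Rn n → ℂ) (x : Rn n) : ℝ≥0∞ :=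
  ⨆ (x₀ : Rn n) (l : ℝ) (_ : 0 < l) (_ : x ∈ cube x₀ l),
    ⨅ c : ℂ, (∫⁻ y in cube x₀ l, (‖u y - c‖₊ : ℝ≥0∞)) / ENNReal.ofReal (l ^ n)

/-- The Muckenhoupt `A₁` condition: `Mω ≤ C ω` a.e. -/
def IsA1 {n : ℕ} (ω : Rn n → ℝ) : Prop :=
  (∀ x, 0 ≤ ω x) ∧ LocallyIntegrable ω volume ∧
  ∃ C : ℝ, 0 < C ∧ ∀ᵐ x : Rn n ∂volume, mHL ω x ≤ ENNReal.ofReal (C * ω x)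

/-- The Muckenhoupt `A_p` condition for `1 < p < ∞`. -/
def IsAp {n : ℕ} (p : ℝ) (ω : Rn n → ℝ) : Prop :=
  (∀ x, 0 ≤ ω x) ∧ LocallyIntegrable ω volume ∧
  ∃ C : ℝ, 0 < C ∧ ∀ (x₀ : Rn n) (l : ℝ), 0 < l →
    ((∫⁻ y in cube x₀ l, ENNReal.ofReal (ω y)) / ENNReal.ofReal (l ^ n)) *
      (((∫⁻ y in cube x₀ l, ENNReal.ofReal (ω y ^ (1 / (1 - p)))) /
          ENNReal.ofReal (l ^ n)) ^ (p - 1))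
      ≤ ENNReal.ofReal C

/-- The weighted measure `ω(s) = ∫_s ω dx`. -/
def wMeas {n : ℕ} (ω : Rn n → ℝ) (s : Set (Rn n)) : ℝ≥0∞ :=
  ∫⁻ x in s, ENNReal.ofReal (ω x)

/-- The weighted `L¹` norm `∫ |u| ω dx`. -/
def wL1 {n : ℕ} (ω : Rn n → ℝ) (u : Rn n → ℂ) : ℝ≥0∞ :=
  ∫⁻ x : Rn n, (‖u x‖₊ : ℝ≥0∞) * ENNReal.ofReal (ω x)

/-- The weighted `L^p` norm `(∫ |u|^p ω dx)^{1/p}`. -/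
def wLp {n : ℕ} (p : ℝ) (ω : Rn n → ℝ) (u : Rn n → ℂ) : ℝ≥0∞ :=
  (∫⁻ x : Rn n, (‖u x‖₊ : ℝ≥0∞) ^ p * ENNReal.ofReal (ω x)) ^ (1 / p)

/-- A Littlewood–Paley cut-off: `ψ ∈ C_c^∞`, `0 ≤ ψ ≤ 1`, supported in the annulus
`{C₀⁻¹ ≤ |ξ| ≤ 2C₀}`. -/
def LPcut {n : ℕ} (C₀ : ℝ) (ψ : Rn n → ℝ) : Prop :=
  ContDiff ℝ (⊤ : ℕ∞) ψ ∧ HasCompactSupport ψ ∧ (∀ ξ, 0 ≤ ψ ξ) ∧ (∀ ξ, ψ ξ ≤ 1) ∧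
  tsupport ψ ⊆ {ξ : Rn n | C₀⁻¹ ≤ ‖ξ‖ ∧ ‖ξ‖ ≤ 2 * C₀}

/-- `K_j(x,y) = (2π)^{-n} ∫ e^{i⟨x-y,ξ⟩} a(x,ξ) ψ(2^{-j}ξ) dξ`. -/
def Kj {n : ℕ} (a : Rn n → Rn n → ℂ) (ψ : Rn n → ℝ) (j : ℕ) (x y : Rn n) : ℂ :=
  ((((2 * π) ^ n)⁻¹ : ℝ) : ℂ) *
    ∫ ξ : Rn n, Complex.exp (Complex.I * ((⟪x - y, ξ⟫_ℝ : ℝ) : ℂ)) * a x ξ *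
      ((ψ ((((2 : ℝ) ^ j)⁻¹) • ξ) : ℝ) : ℂ)

/-- `K_j^*(x,y) = (2π)^{-n} ∫ e^{i⟨x-y,ξ⟩} a(y,ξ) ψ(2^{-j}ξ) dξ`. -/
def KjStar {n : ℕ} (a : Rn n → Rn n → ℂ) (ψ : Rn n → ℝ) (j : ℕ) (x y : Rn n) : ℂ :=
  ((((2 * π) ^ n)⁻¹ : ℝ) : ℂ) *
    ∫ ξ : Rn n, Complex.exp (Complex.I * ((⟪x - y, ξ⟫_ℝ : ℝ) : ℂ)) * a y ξ *
      ((ψ ((((2 : ℝ) ^ j)⁻¹) • ξ) : ℝ) : ℂ)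

/-- `T_j u(x) = ∫ K_j(x,y) u(y) dy`. -/
def Tj {n : ℕ} (a : Rn n → Rn n → ℂ) (ψ : Rn n → ℝ) (j : ℕ) (u : Rn n → ℂ) (x : Rn n) : ℂ :=
  ∫ y : Rn n, Kj a ψ j x y * u y

/-- `T_j^* u(x) = ∫ K_j^*(x,y) u(y) dy`. -/
def TjStar {n : ℕ} (a : Rn n → Rn n → ℂ) (ψ : Rn n → ℝ) (j : ℕ) (u : Rn n → ℂ) (x : Rn n) : ℂ :=
  ∫ y : Rn n, KjStar a ψ j x y * u y

/-- The Fourier integral operator `T_{a,φ} u(x) = ∫ e^{iφ(x,ξ)} a(x,ξ) û(ξ) dξ`. -/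
def fio {n : ℕ} (a : Rn n → Rn n → ℂ) (φ : Rn n → Rn n → ℝ) (u : Rn n → ℂ) (x : Rn n) : ℂ :=
  ∫ ξ : Rn n, Complex.exp (Complex.I * ((φ x ξ : ℝ) : ℂ)) * a x ξ * ft u ξ

/-- The dual FIO `T^*_{a,φ} u(x) = ∫∫ e^{i(φ(y,ξ)-⟨x,ξ⟩)} a(y,ξ) dξ u(y) dy`. -/
def fioDual {n : ℕ} (a : Rn n → Rn n → ℂ) (φ : Rn n → Rn n → ℝ) (u : Rn n → ℂ) (x : Rn n) : ℂ :=
  ∫ y : Rn n,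
    (∫ ξ : Rn n, Complex.exp (Complex.I * ((φ y ξ - ⟪x, ξ⟫_ℝ : ℝ) : ℂ)) * a y ξ) * u y

/-- The phase class `Φ¹`: smooth on `ℝⁿ × (ℝⁿ∖{0})`, positively homogeneous of degree 1 in `ξ`,
with `sup |ξ|^{-1+|α|} |∂^α_ξ ∂^β_x φ| ≤ C_{α,β}` for `|α|+|β| ≥ 1`. -/
def Phi1 {n : ℕ} (φ : Rn n → Rn n → ℝ) : Prop :=
  ContDiffOn ℝ (⊤ : ℕ∞) (Function.uncurry φ) {p : Rn n × Rn n | p.2 ≠ 0} ∧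
  (∀ x : Rn n, ∀ ξ : Rn n, ξ ≠ 0 → ∀ t : ℝ, 0 < t → φ x (t • ξ) = t * φ x ξ) ∧
  ∀ k l : ℕ, 1 ≤ k + l → ∃ C : ℝ, 0 < C ∧ ∀ x ξ : Rn n, ξ ≠ 0 →
    ‖ξ‖ ^ ((k : ℝ) - 1) *
        ‖iteratedFDeriv ℝ k (fun η : Rn n => iteratedFDeriv ℝ l (fun y : Rn n => φ y η) x) ξ‖
      ≤ C

/-- The rough phase class `L^∞Φ¹`: positively homogeneous of degree 1 in `ξ`, smooth in `ξ` away
from the origin, bounded measurable in `x`, with `sup |ξ|^{-1+|α|} ‖∂^α_ξ φ(·,ξ)‖_{L^∞} ≤ C_α`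
for `|α| ≥ 1`. -/
def LinfPhi1 {n : ℕ} (φ : Rn n → Rn n → ℝ) : Prop :=
  (∀ x : Rn n, ContDiffOn ℝ (⊤ : ℕ∞) (φ x) {ξ : Rn n | ξ ≠ 0}) ∧
  (∀ ξ : Rn n, Measurable fun x : Rn n => φ x ξ) ∧
  (∀ ξ : Rn n, ∃ C : ℝ, ∀ x : Rn n, |φ x ξ| ≤ C) ∧
  (∀ x : Rn n, ∀ ξ : Rn n, ξ ≠ 0 → ∀ t : ℝ, 0 < t → φ x (t • ξ) = t * φ x ξ) ∧
  ∀ k : ℕ, 1 ≤ k → ∃ C : ℝ, 0 < C ∧ ∀ ξ : Rn n, ξ ≠ 0 → ∀ᵐ x : Rn n ∂volume,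
    ‖ξ‖ ^ ((k : ℝ) - 1) * ‖iteratedFDeriv ℝ k (φ x) ξ‖ ≤ C

theorem iteratedDeriv_cexp_I_mul_ofReal (k : ℕ) :
    iteratedDeriv k (fun t : ℝ => Complex.exp (Complex.I * (t : ℂ))) =
      fun t : ℝ => Complex.I ^ k * Complex.exp (Complex.I * (t : ℂ)) := by
  induction k with
  | zero => simp
  | succ k ih =>
    rw [iteratedDeriv_succ, ih]
    funext t
    have h : HasDerivAt (fun t : ℝ => Complex.exp (Complex.I * (t : ℂ)))
        (Complex.exp (Complex.I * (t : ℂ)) * (Complex.I * 1)) t :=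
      ((Complex.ofRealCLM.hasDerivAt (x := t)).const_mul Complex.I).cexp
    rw [(h.const_mul (Complex.I ^ k)).deriv]
    ring

/-- The character `ξ ↦ e^{i⟨p,ξ⟩}`. -/
def expChar {n : ℕ} (p ξ : Rn n) : ℂ := Complex.exp (Complex.I * ((⟪p, ξ⟫_ℝ : ℝ) : ℂ))

theorem contDiff_expChar {n : ℕ} (p : Rn n) : ContDiff ℝ (⊤ : ℕ∞) (expChar p) := by
  unfold expChar
  have : ContDiff ℝ (⊤ : ℕ∞) fun ξ : Rn n => ((⟪p, ξ⟫_ℝ : ℝ) : ℂ) :=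
    Complex.ofRealCLM.contDiff.comp (contDiff_const.inner ℝ contDiff_id)
  exact (contDiff_const.mul this).cexp

theorem expChar_add {n : ℕ} (p q ξ : Rn n) :
    expChar (p + q) ξ = expChar p ξ * expChar q ξ := by
  simp only [expChar, inner_add_left, ← Complex.exp_add]
  push_cast
  ring_nf

theorem norm_iteratedFDeriv_expChar_le {n : ℕ} (p ξ : Rn n) (k : ℕ) :
    ‖iteratedFDeriv ℝ k (expChar p) ξ‖ ≤ ‖p‖ ^ k := by
  have hg : ContDiff ℝ (⊤ : ℕ∞) fun t : ℝ => Complex.exp (Complex.I * (t : ℂ)) :=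
    (contDiff_const.mul Complex.ofRealCLM.contDiff).cexp
  have h : expChar p = (fun t : ℝ => Complex.exp (Complex.I * (t : ℂ))) ∘ innerSL ℝ p := by
    funext ξ
    simp [expChar]
  rw [h, (innerSL ℝ p).iteratedFDeriv_comp_right hg ξ (i := k) (by exact_mod_cast le_top)]
  refine (ContinuousMultilinearMap.norm_compContinuousLinearMap_le _ _).trans ?_
  rw [norm_iteratedFDeriv_eq_norm_iteratedDeriv, iteratedDeriv_cexp_I_mul_ofReal]
  simp [Complex.norm_exp]

theorem norm_iteratedFDeriv_expChar_sub_one_le {n : ℕ} (p ξ : Rn n) (k : ℕ) :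
    ‖iteratedFDeriv ℝ k (fun ξ => expChar p ξ - 1) ξ‖ ≤
      if k = 0 then ‖p‖ * ‖ξ‖ else ‖p‖ ^ k := by
  split_ifs with hk
  · subst hk
    rw [norm_iteratedFDeriv_zero, expChar]
    refine (Real.norm_exp_I_mul_ofReal_sub_one_le).trans ?_
    exact norm_inner_le_norm p ξ
  · rw [fun_iteratedFDeriv_sub_apply
      ((contDiff_expChar p).of_le (by exact_mod_cast le_top)).contDiffAt contDiffAt_const,
      iteratedFDeriv_const_of_ne hk]
    simpa using norm_iteratedFDeriv_expChar_le p ξ k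

theorem norm_iteratedFDeriv_mul_le_of_le {E : Type*} [NormedAddCommGroup E] [NormedSpace ℝ E]
    {f g : E → ℂ} (hf : ContDiff ℝ (⊤ : ℕ∞) f) (hg : ContDiff ℝ (⊤ : ℕ∞) g) {N : ℕ} {A B : ℝ}
    {ξ : E} (hA : ∀ k ≤ N, ‖iteratedFDeriv ℝ k f ξ‖ ≤ A)
    (hB : ∀ k ≤ N, ‖iteratedFDeriv ℝ k g ξ‖ ≤ B) (k : ℕ) (hk : k ≤ N) :
    ‖iteratedFDeriv ℝ k (fun ξ => f ξ * g ξ) ξ‖ ≤ 2 ^ N * (A * B) := by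
  have hA0 : 0 ≤ A := (norm_nonneg _).trans (hA 0 (Nat.zero_le _))
  have hB0 : 0 ≤ B := (norm_nonneg _).trans (hB 0 (Nat.zero_le _))
  calc ‖iteratedFDeriv ℝ k (fun ξ => f ξ * g ξ) ξ‖
      ≤ ∑ i ∈ Finset.range (k + 1), (k.choose i : ℝ) * ‖iteratedFDeriv ℝ i f ξ‖ *
          ‖iteratedFDeriv ℝ (k - i) g ξ‖ :=
        norm_iteratedFDeriv_mul_le hf hg ξ (by exact_mod_cast le_top)
    _ ≤ ∑ i ∈ Finset.range (k + 1), (k.choose i : ℝ) * (A * B) := by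
        refine Finset.sum_le_sum fun i hi => ?_
        rw [mul_assoc]
        have hi' : i ≤ k := by simpa [Nat.lt_succ_iff] using hi
        gcongr
        · exact hA i (hi'.trans hk)
        · exact hB _ ((Nat.sub_le _ _).trans hk)
    _ = 2 ^ k * (A * B) := by
        rw [← Finset.sum_mul]
        congr 1
        exact_mod_cast Nat.sum_range_choose k
    _ ≤ 2 ^ N * (A * B) := by gcongr; norm_num

/-- Partial iterated derivatives in the second variable depend differentiably on the first. -/
theorem differentiable_iteratedFDeriv_right {n : ℕ} {a : Rn n → Rn n → ℂ}
    (ha : ContDiff ℝ (⊤ : ℕ∞) (Function.uncurry a)) (k : ℕ) (ξ : Rn n) :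
    Differentiable ℝ fun y : Rn n => iteratedFDeriv ℝ k (fun η : Rn n => a y η) ξ := by
  have h : (fun y : Rn n => iteratedFDeriv ℝ k (fun η : Rn n => a y η) ξ) = fun y =>
      ContinuousMultilinearMap.compContinuousLinearMapL
        (fun _ : Fin k => ContinuousLinearMap.inr ℝ (Rn n) (Rn n))
        (iteratedFDeriv ℝ k (Function.uncurry a) (y, ξ)) := by
    funext y
    have h1 : (fun η : Rn n => a y η) = (fun w => Function.uncurry a ((y, 0) + w)) ∘
        ContinuousLinearMap.inr ℝ (Rn n) (Rn n) := by
      funext η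
      simp [Function.uncurry]
    have h2 : ContDiff ℝ (⊤ : ℕ∞) fun w => Function.uncurry a ((y, 0) + w) :=
      ha.comp (contDiff_const.add contDiff_id)
    rw [h1, ContinuousLinearMap.iteratedFDeriv_comp_right _ h2 ξ (by exact_mod_cast le_top),
      iteratedFDeriv_comp_add_left]
    simp
  rw [h]
  refine (ContinuousLinearMap.differentiable _).comp ?_
  have h3 : ContDiff ℝ 1 (iteratedFDeriv ℝ k (Function.uncurry a)) :=
    ha.iteratedFDeriv_right (by exact_mod_cast le_top)
  exact (h3.differentiable one_ne_zero).comp (differentiable_id.prodMk (differentiable_const ξ))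

theorem norm_iteratedFDeriv_sub_le {n : ℕ} {a : Rn n → Rn n → ℂ}
    (ha : ContDiff ℝ (⊤ : ℕ∞) (Function.uncurry a)) (k : ℕ) (ξ : Rn n) {A : ℝ}
    (hA : ∀ x, ‖iteratedFDeriv ℝ 1
      (fun y : Rn n => iteratedFDeriv ℝ k (fun η : Rn n => a y η) ξ) x‖ ≤ A) (x z : Rn n) :
    ‖iteratedFDeriv ℝ k (fun η => a x η - a z η) ξ‖ ≤ A * ‖x - z‖ := by
  have hs : ∀ y, ContDiff ℝ (⊤ : ℕ∞) (a y) := fun y =>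
    ha.comp (contDiff_const.prodMk contDiff_id)
  rw [fun_iteratedFDeriv_sub_apply ((hs x).of_le (by exact_mod_cast le_top)).contDiffAt
    ((hs z).of_le (by exact_mod_cast le_top)).contDiffAt]
  refine Convex.norm_image_sub_le_of_norm_fderiv_le
    (f := fun y : Rn n => iteratedFDeriv ℝ k (fun η : Rn n => a y η) ξ) (s := Set.univ)
    (𝕜 := ℝ) (fun y _ => differentiable_iteratedFDeriv_right ha k ξ y) (fun y _ => ?_)
    convex_univ (Set.mem_univ _) (Set.mem_univ _)
  rw [← norm_iteratedFDeriv_one]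
  exact hA y

theorem exists_pow_mul_norm_integral_expChar_le (n N : ℕ) : ∃ C : ℝ, 0 < C ∧
    ∀ (G : Rn n → ℂ) (R A : ℝ), 0 ≤ R → 0 ≤ A → ContDiff ℝ (⊤ : ℕ∞) G →
      tsupport G ⊆ Metric.closedBall 0 R →
      (∀ ξ, ∀ k ≤ N, ‖iteratedFDeriv ℝ k G ξ‖ ≤ A) →
      ∀ p : Rn n, ∀ k ≤ N, ‖p‖ ^ k * ‖∫ ξ, expChar p ξ * G ξ‖ ≤ C * (A * R ^ n) := by
  set V : ℝ := volume.real (Metric.ball (0 : Rn n) 1) with hV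
  have hV0 : 0 ≤ V := measureReal_nonneg
  refine ⟨(2 * π) ^ N * (2 ^ N * ((N + 1) * (V + 1))), by positivity, ?_⟩
  intro G R A hR hA hG hsupp hbd p k hk
  have hcs : HasCompactSupport G :=
    (isCompact_closedBall (0 : Rn n) R).of_isClosed_subset (isClosed_tsupport G) hsupp
  have hint : ∀ m : ℕ, Integrable fun v => ‖iteratedFDeriv ℝ m G v‖ := fun m =>
    ((hG.continuous_iteratedFDeriv (m := m)
      (by exact_mod_cast le_top)).integrable_of_hasCompactSupport (hcs.iteratedFDeriv m)).norm
  have hI : ∀ m ≤ N, ∫ v, ‖iteratedFDeriv ℝ m G v‖ ≤ A * R ^ n * (V + 1) := by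
    intro m hm
    have hz : ∀ v, v ∉ Metric.closedBall (0 : Rn n) R → ‖iteratedFDeriv ℝ m G v‖ = 0 := by
      intro v hv
      by_contra h
      exact hv (hsupp (support_iteratedFDeriv_subset m
        (Function.mem_support.2 fun h0 => h (by rw [h0, norm_zero]))))
    rw [← setIntegral_eq_integral_of_forall_compl_eq_zero hz]
    have h1 := norm_setIntegral_le_of_norm_le_const (μ := volume)
      (s := Metric.closedBall (0 : Rn n) R) (f := fun v => ‖iteratedFDeriv ℝ m G v‖) (C := A)
      measure_closedBall_lt_top (fun v _ => by simpa using hbd v m hm)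
    rw [Measure.addHaar_real_closedBall volume (0 : Rn n) hR, finrank_euclideanSpace_fin] at h1
    calc _ ≤ A * (R ^ n * V) := (le_abs_self _).trans h1
      _ = A * R ^ n * V := by ring
      _ ≤ A * R ^ n * (V + 1) := by gcongr; linarith
  have hF : ∫ ξ, expChar p ξ * G ξ = FourierTransform.fourier G (-((2 * π)⁻¹ • p)) := by
    rw [Real.fourier_eq']
    refine integral_congr_ae (Filter.Eventually.of_forall fun ξ => ?_)
    simp only [expChar, inner_neg_right, inner_smul_right, smul_eq_mul, real_inner_comm p ξ]
    congr 2
    rw [mul_comm]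
    congr 2
    field_simp
  have key := Real.pow_mul_norm_iteratedFDeriv_fourier_le (f := G) (K := 0) (N := (⊤ : ℕ∞))
    hG (fun i m hi _ => by
      have : i = 0 := by simpa using hi
      subst this
      simpa using hint m) (k := 0) (n := k) (by simp) le_top (-((2 * π)⁻¹ • p))
  rw [norm_iteratedFDeriv_zero, ← hF, norm_neg, norm_smul, norm_inv, mul_pow, inv_pow,
    Finset.sum_product] at key
  simp only [zero_add, Finset.range_one, Finset.sum_singleton, pow_zero, one_mul, Nat.cast_zero,
    mul_zero] at key
  rw [Real.norm_of_nonneg (by positivity : 0 ≤ 2 * π)] at key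
  have h2 : ∑ m ∈ Finset.range (k + 1), ∫ v, ‖iteratedFDeriv ℝ m G v‖ ≤
      (N + 1) * (A * R ^ n * (V + 1)) := by
    calc _ ≤ ∑ m ∈ Finset.range (k + 1), A * R ^ n * (V + 1) :=
          Finset.sum_le_sum fun m hm => hI m (by simp at hm; omega)
      _ = (k + 1) * (A * R ^ n * (V + 1)) := by simp
      _ ≤ _ := by gcongr
  have hπ : 1 ≤ 2 * π := by linarith [Real.pi_gt_three]
  calc ‖p‖ ^ k * ‖∫ ξ, expChar p ξ * G ξ‖
      = (2 * π) ^ k * (((2 * π) ^ k)⁻¹ * ‖p‖ ^ k * ‖∫ ξ, expChar p ξ * G ξ‖) := by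
        field_simp
    _ ≤ (2 * π) ^ k * (2 ^ k * ((N + 1) * (A * R ^ n * (V + 1)))) := by
        exact mul_le_mul_of_nonneg_left
          (key.trans (mul_le_mul_of_nonneg_left h2 (by positivity))) (by positivity)
    _ ≤ (2 * π) ^ N * (2 ^ N * ((N + 1) * (A * R ^ n * (V + 1)))) := by
        gcongr
        · norm_num
    _ = _ := by ring

theorem isClosed_cube {n : ℕ} (x₀ : Rn n) (l : ℝ) : IsClosed (cube x₀ l) := by
  have : cube x₀ l = ⋂ i, {y : Rn n | |y i - x₀ i| ≤ l / 2} := by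
    ext y
    simp [cube]
  rw [this]
  exact isClosed_iInter fun i => isClosed_le (by fun_prop) continuous_const

theorem mem_cube_of_norm_sub_le {n : ℕ} {x₀ y : Rn n} {r : ℝ} (h : ‖x₀ - y‖ ≤ r) :
    y ∈ cube x₀ (2 * r) := by
  intro i
  have := PiLp.norm_apply_le (x₀ - y) i
  rw [PiLp.sub_apply, Real.norm_eq_abs, abs_sub_comm] at this
  linarith

theorem norm_sub_le_of_mem_cube {n : ℕ} {x₀ y : Rn n} {l : ℝ} (hl : 0 ≤ l) (h : y ∈ cube x₀ l) :
    ‖y - x₀‖ ≤ n * l := by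
  refine abs_le_of_sq_le_sq' ?_ (by positivity) |>.2
  rw [EuclideanSpace.norm_sq_eq]
  have h1 : ∀ i, ‖(y - x₀) i‖ ^ 2 ≤ l ^ 2 := fun i => by
    have := h i
    rw [PiLp.sub_apply, Real.norm_eq_abs]
    gcongr
    linarith
  have h2 : (n : ℝ) ≤ (n : ℝ) ^ 2 := by exact_mod_cast Nat.le_self_pow two_ne_zero n
  calc ∑ i, ‖(y - x₀) i‖ ^ 2 ≤ ∑ _i : Fin n, l ^ 2 := Finset.sum_le_sum fun i _ => h1 i
    _ = n * l ^ 2 := by simp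
    _ ≤ n ^ 2 * l ^ 2 := by gcongr
    _ = (n * l) ^ 2 := by ring

theorem setLIntegral_cube_le_mHL {n : ℕ} (u : Rn n → ℂ) (x₀ : Rn n) {l : ℝ} (hl : 0 < l) :
    ∫⁻ y in cube x₀ l, (‖u y‖₊ : ℝ≥0∞) ≤ ENNReal.ofReal (l ^ n) * mHL u x₀ := by
  have hx : x₀ ∈ cube x₀ l := fun i => by simp; positivity
  have h : (∫⁻ y in cube x₀ l, (‖u y‖₊ : ℝ≥0∞)) / ENNReal.ofReal (l ^ n) ≤ mHL u x₀ :=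
    le_iSup_of_le x₀ <| le_iSup_of_le l <| le_iSup_of_le hl <| le_iSup_of_le hx le_rfl
  rw [mul_comm]
  exact (ENNReal.div_le_iff (by simpa using pow_pos hl n) ENNReal.ofReal_ne_top).1 h

/-- A kernel with decay `min(1, |x₀ - y|^{-(n+1)})` is controlled by the maximal function. -/
theorem lintegral_mul_le_mHL {n : ℕ} {u k : Rn n → ℂ} (hu : Continuous u) (x₀ : Rn n) {B : ℝ}
    (hB : 0 ≤ B) (h0 : ∀ y, ‖k y‖ ≤ B) (h1 : ∀ y, ‖x₀ - y‖ ^ (n + 1) * ‖k y‖ ≤ B) :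
    ∫⁻ y, (‖u y‖₊ : ℝ≥0∞) * (‖k y‖₊ : ℝ≥0∞) ≤
      ENNReal.ofReal (2 ^ (2 * n + 2) * B) * mHL u x₀ := by
  set c : ℕ → ℝ := fun m => 2 ^ (n + 1) * B * ((2 : ℝ) ^ m)⁻¹ ^ (n + 1) with hc
  have hc0 : ∀ m, 0 ≤ c m := fun m => by positivity
  set Q : ℕ → Set (Rn n) := fun m => cube x₀ (2 * 2 ^ m) with hQ
  have hQm : ∀ m, MeasurableSet (Q m) := fun m => (isClosed_cube _ _).measurableSet
  have hpt : ∀ y, ∃ m, y ∈ Q m ∧ ‖k y‖ ≤ c m := by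
    intro y
    by_cases hy : ‖x₀ - y‖ ≤ 1
    · refine ⟨0, mem_cube_of_norm_sub_le (by simpa using hy), (h0 y).trans ?_⟩
      simp only [hc, pow_zero, inv_one, one_pow, mul_one]
      exact le_mul_of_one_le_left hB (one_le_pow₀ one_le_two)
    · push Not at hy
      obtain ⟨m, hm1, hm2⟩ := exists_nat_pow_near hy.le one_lt_two
      refine ⟨m + 1, mem_cube_of_norm_sub_le hm2.le, ?_⟩
      have h2 : (2 ^ m) ^ (n + 1) * ‖k y‖ ≤ B :=
        le_trans (by gcongr) (h1 y)
      have h3 : c (m + 1) = B / (2 ^ m) ^ (n + 1) := by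
        simp only [hc]
        rw [pow_succ 2 m, mul_inv, mul_pow, inv_pow, inv_pow]
        field_simp
      rw [h3, le_div_iff₀ (by positivity), mul_comm]
      exact h2
  have hle : ∀ y, (‖u y‖₊ : ℝ≥0∞) * (‖k y‖₊ : ℝ≥0∞) ≤
      ∑' m, (Q m).indicator (fun y => ENNReal.ofReal (c m) * (‖u y‖₊ : ℝ≥0∞)) y := by
    intro y
    obtain ⟨m, hm, hk⟩ := hpt y
    refine le_trans ?_ (ENNReal.le_tsum m)
    rw [Set.indicator_of_mem hm, mul_comm]
    gcongr
    rw [← enorm_eq_nnnorm, ← ofReal_norm]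
    exact ENNReal.ofReal_le_ofReal hk
  have hum : Measurable fun y => (‖u y‖₊ : ℝ≥0∞) := by fun_prop
  have hterm : ∀ m, ∫⁻ y, (Q m).indicator
      (fun y => ENNReal.ofReal (c m) * (‖u y‖₊ : ℝ≥0∞)) y ≤
      ENNReal.ofReal (2 ^ (2 * n + 1) * B * (1 / 2) ^ m) * mHL u x₀ := by
    intro m
    rw [lintegral_indicator (hQm m), lintegral_const_mul _ hum]
    refine (mul_le_mul_right (setLIntegral_cube_le_mHL u x₀ (by positivity)) _).trans ?_
    rw [← mul_assoc, ← ENNReal.ofReal_mul (hc0 m)]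
    refine mul_le_mul_left (ENNReal.ofReal_le_ofReal (le_of_eq ?_)) _
    simp only [hc]
    rw [mul_pow, pow_succ (((2 : ℝ) ^ m)⁻¹), one_div, inv_pow, inv_pow]
    field_simp
    ring
  calc ∫⁻ y, (‖u y‖₊ : ℝ≥0∞) * (‖k y‖₊ : ℝ≥0∞)
      ≤ ∫⁻ y, ∑' m, (Q m).indicator (fun y => ENNReal.ofReal (c m) * (‖u y‖₊ : ℝ≥0∞)) y :=
        lintegral_mono hle
    _ = ∑' m, ∫⁻ y, (Q m).indicator (fun y => ENNReal.ofReal (c m) * (‖u y‖₊ : ℝ≥0∞)) y :=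
        lintegral_tsum fun m => ((hum.const_mul _).indicator (hQm m)).aemeasurable
    _ ≤ ∑' m : ℕ, ENNReal.ofReal (2 ^ (2 * n + 1) * B * (1 / 2) ^ m) * mHL u x₀ :=
        ENNReal.tsum_le_tsum hterm
    _ = ENNReal.ofReal (2 ^ (2 * n + 2) * B) * mHL u x₀ := by
        rw [ENNReal.tsum_mul_right, ← ENNReal.ofReal_tsum_of_nonneg (fun m => by positivity)
          (summable_geometric_two.mul_left _), tsum_mul_left, tsum_geometric_two]
        congr 2
        ring

theorem exists_forall_le_of_forall_exists {ι : Type*} {f : ℕ → ι → ℝ} {g : ℕ → ι → ℝ}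
    (hg : ∀ k i, 0 ≤ g k i) (h : ∀ k, ∃ C : ℝ, 0 < C ∧ ∀ i, f k i ≤ C * g k i) (N : ℕ) :
    ∃ C : ℝ, 0 < C ∧ ∀ k ≤ N, ∀ i, f k i ≤ C * g k i := by
  choose C hC0 hC using h
  refine ⟨∑ k ∈ Finset.range (N + 1), C k,
    Finset.sum_pos (fun k _ => hC0 k) ⟨0, by simp⟩, fun k hk i => (hC k i).trans ?_⟩
  exact mul_le_mul_of_nonneg_right (Finset.single_le_sum (f := C) (fun k _ => (hC0 k).le)
    (Finset.mem_range.2 (Nat.lt_succ_of_le hk))) (hg k i)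

theorem one_add_sq_rpow_le {n : ℕ} {C₀ s r : ℝ} (hC₀ : 1 < C₀) (hs : 1 ≤ s)
    (hr : C₀⁻¹ * s ≤ r) : (1 + r ^ 2) ^ (-(n : ℝ) / 2) ≤ C₀ ^ n * (s ^ n)⁻¹ := by
  have hpos : 0 < C₀⁻¹ * s := by positivity
  have h1 : (C₀⁻¹ * s) ^ 2 ≤ 1 + r ^ 2 := by
    have : (C₀⁻¹ * s) ^ 2 ≤ r ^ 2 := by gcongr
    linarith
  calc (1 + r ^ 2) ^ (-(n : ℝ) / 2) ≤ ((C₀⁻¹ * s) ^ 2) ^ (-(n : ℝ) / 2) :=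
        Real.rpow_le_rpow_of_nonpos (by positivity) h1 (by
          have : (0 : ℝ) ≤ n := n.cast_nonneg
          linarith)
    _ = C₀ ^ n * (s ^ n)⁻¹ := by
        rw [← Real.rpow_natCast (C₀⁻¹ * s) 2, ← Real.rpow_mul hpos.le]
        have : ((2 : ℕ) : ℝ) * (-(n : ℝ) / 2) = -(n : ℝ) := by push_cast; ring
        rw [this, Real.rpow_neg hpos.le, Real.rpow_natCast, mul_pow, mul_inv, inv_pow, inv_inv]

theorem one_add_sq_rpow_le' {n : ℕ} {C₀ s r δ : ℝ} (hC₀ : 1 < C₀) (hs : 1 ≤ s)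
    (hr : C₀⁻¹ * s ≤ r) (hr' : r ≤ 2 * C₀ * s) (hδ : δ ≤ 1) :
    (1 + r ^ 2) ^ ((-(n : ℝ) + δ) / 2) ≤ C₀ ^ n * (s ^ n)⁻¹ * (3 * C₀ * s) := by
  have hr0 : 0 ≤ r := le_trans (by positivity) hr
  rw [add_div, Real.rpow_add (by positivity)]
  refine mul_le_mul (one_add_sq_rpow_le hC₀ hs hr) ?_ (by positivity) (by positivity)
  have hCs : 1 ≤ C₀ * s := one_le_mul_of_one_le_of_one_le hC₀.le hs
  calc (1 + r ^ 2) ^ (δ / 2) ≤ (1 + r ^ 2) ^ ((1 : ℝ) / 2) :=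
        Real.rpow_le_rpow_of_exponent_le (by nlinarith [sq_nonneg r]) (by linarith)
    _ = √(1 + r ^ 2) := (Real.sqrt_eq_rpow _).symm
    _ ≤ 1 + r := Real.sqrt_le_iff.2 ⟨by positivity, by nlinarith⟩
    _ ≤ 3 * C₀ * s := by linarith

/-- Derivative bounds for a symbol and its increments in `x` on the annulus `|ξ| ~ s`. -/
theorem HormClass.exists_bound {n : ℕ} {δ : ℝ} (hδ1 : δ ≤ 1) {a : Rn n → Rn n → ℂ}
    (ha : HormClass (-(n : ℝ)) 0 δ a) {C₀ : ℝ} (hC₀ : 1 < C₀) (N : ℕ) :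
    ∃ M : ℝ, 0 < M ∧ ∀ s : ℝ, 1 ≤ s → ∀ ξ : Rn n, C₀⁻¹ * s ≤ ‖ξ‖ → ‖ξ‖ ≤ 2 * C₀ * s →
      ∀ k ≤ N, ∀ x z : Rn n, ‖iteratedFDeriv ℝ k (a x) ξ‖ ≤ M * (s ^ n)⁻¹ ∧
        ‖iteratedFDeriv ℝ k (fun η => a x η - a z η) ξ‖ ≤ M * (s ^ n)⁻¹ * (s * ‖x - z‖) := by
  obtain ⟨hsm, hbd⟩ := ha
  obtain ⟨M₀, hM₀, h0⟩ := exists_forall_le_of_forall_exists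
    (f := fun k (i : Rn n × Rn n) => ‖iteratedFDeriv ℝ k (a i.1) i.2‖)
    (g := fun _ i => (1 + ‖i.2‖ ^ 2) ^ (-(n : ℝ) / 2)) (fun _ _ => by positivity)
    (fun k => by
      obtain ⟨C, hC, h⟩ := hbd k 0
      exact ⟨C, hC, fun i => by simpa using h i.1 i.2⟩) N
  obtain ⟨M₁, hM₁, h1⟩ := exists_forall_le_of_forall_exists
    (f := fun k (i : Rn n × Rn n) => ‖iteratedFDeriv ℝ 1
      (fun y : Rn n => iteratedFDeriv ℝ k (fun η : Rn n => a y η) i.2) i.1‖)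
    (g := fun _ i => (1 + ‖i.2‖ ^ 2) ^ ((-(n : ℝ) + δ) / 2)) (fun _ _ => by positivity)
    (fun k => by
      obtain ⟨C, hC, h⟩ := hbd k 1
      exact ⟨C, hC, fun i => by simpa using h i.1 i.2⟩) N
  refine ⟨(M₀ + M₁ * (3 * C₀)) * C₀ ^ n, by positivity, fun s hs ξ hξ hξ' k hk x z => ⟨?_, ?_⟩⟩
  · calc ‖iteratedFDeriv ℝ k (a x) ξ‖ ≤ M₀ * (1 + ‖ξ‖ ^ 2) ^ (-(n : ℝ) / 2) := h0 k hk (x, ξ)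
      _ ≤ M₀ * (C₀ ^ n * (s ^ n)⁻¹) :=
          mul_le_mul_of_nonneg_left (one_add_sq_rpow_le hC₀ hs hξ) hM₀.le
      _ = M₀ * C₀ ^ n * (s ^ n)⁻¹ := by ring
      _ ≤ (M₀ + M₁ * (3 * C₀)) * C₀ ^ n * (s ^ n)⁻¹ := by
          gcongr
          exact le_add_of_nonneg_right (by positivity)
  · calc ‖iteratedFDeriv ℝ k (fun η => a x η - a z η) ξ‖
        ≤ M₁ * (1 + ‖ξ‖ ^ 2) ^ ((-(n : ℝ) + δ) / 2) * ‖x - z‖ :=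
          norm_iteratedFDeriv_sub_le hsm k ξ (fun y => h1 k hk (y, ξ)) x z
      _ ≤ M₁ * (C₀ ^ n * (s ^ n)⁻¹ * (3 * C₀ * s)) * ‖x - z‖ := by
          gcongr
          exact one_add_sq_rpow_le' hC₀ hs hξ hξ' hδ1
      _ = M₁ * (3 * C₀) * C₀ ^ n * (s ^ n)⁻¹ * (s * ‖x - z‖) := by ring
      _ ≤ (M₀ + M₁ * (3 * C₀)) * C₀ ^ n * (s ^ n)⁻¹ * (s * ‖x - z‖) := by
          gcongr
          exact le_add_of_nonneg_left hM₀.le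

/-- The dilated cut-off `ψ(s⁻¹ξ)`, complex valued. -/
def dilCut {n : ℕ} (ψ : Rn n → ℝ) (s : ℝ) (ξ : Rn n) : ℂ := ((ψ (s⁻¹ • ξ) : ℝ) : ℂ)

theorem contDiff_dilCut {n : ℕ} {ψ : Rn n → ℝ} (hψ : ContDiff ℝ (⊤ : ℕ∞) ψ) (s : ℝ) :
    ContDiff ℝ (⊤ : ℕ∞) (dilCut ψ s) :=
  Complex.ofRealCLM.contDiff.comp (hψ.comp (contDiff_const_smul s⁻¹))

theorem LPcut.mem_annulus {n : ℕ} {C₀ : ℝ} {ψ : Rn n → ℝ} (hψ : LPcut C₀ ψ) {s : ℝ} (hs : 0 < s)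
    {ξ : Rn n} (hξ : ξ ∈ tsupport (dilCut ψ s)) : C₀⁻¹ * s ≤ ‖ξ‖ ∧ ‖ξ‖ ≤ 2 * C₀ * s := by
  have h : tsupport (dilCut ψ s) ⊆ (fun ξ : Rn n => s⁻¹ • ξ) ⁻¹' tsupport ψ := by
    refine closure_minimal (fun η hη => subset_closure ?_)
      ((isClosed_tsupport ψ).preimage (continuous_const_smul _))
    intro h0
    exact hη (by simp [dilCut, h0])
  obtain ⟨h1, h2⟩ := hψ.2.2.2.2 (h hξ)
  rw [norm_smul, norm_inv, Real.norm_of_nonneg hs.le, inv_mul_eq_div] at h1 h2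
  exact ⟨(le_div_iff₀ hs).1 h1, (div_le_iff₀ hs).1 h2⟩

theorem LPcut.exists_bound {n : ℕ} {C₀ : ℝ} {ψ : Rn n → ℝ} (hψ : LPcut C₀ ψ) (N : ℕ) :
    ∃ D : ℝ, 0 < D ∧ ∀ s : ℝ, 1 ≤ s → ∀ k ≤ N, ∀ ξ, ‖iteratedFDeriv ℝ k (dilCut ψ s) ξ‖ ≤ D := by
  have hsm : ContDiff ℝ (⊤ : ℕ∞) fun ξ => ((ψ ξ : ℝ) : ℂ) := Complex.ofRealCLM.contDiff.comp hψ.1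
  have hcs : HasCompactSupport fun ξ => ((ψ ξ : ℝ) : ℂ) :=
    hψ.2.1.comp_left (g := fun t : ℝ => (t : ℂ)) Complex.ofReal_zero
  obtain ⟨D, hD, h⟩ := exists_forall_le_of_forall_exists
    (f := fun k (ξ : Rn n) => ‖iteratedFDeriv ℝ k (fun ξ => ((ψ ξ : ℝ) : ℂ)) ξ‖)
    (g := fun _ _ => 1) (fun _ _ => zero_le_one)
    (fun k => by
      obtain ⟨C, hC⟩ := (hcs.iteratedFDeriv (𝕜 := ℝ) k).exists_bound_of_continuous
        (hsm.continuous_iteratedFDeriv (m := k) (by exact_mod_cast le_top))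
      exact ⟨max C 1, by positivity, fun ξ => by simpa using Or.inl (hC ξ)⟩) N
  refine ⟨D, hD, fun s hs k hk ξ => ?_⟩
  have hs' : ‖s⁻¹‖ ≤ 1 := by
    rw [norm_inv, Real.norm_of_nonneg (zero_le_one.trans hs)]
    exact inv_le_one_of_one_le₀ hs
  have e : iteratedFDeriv ℝ k (dilCut ψ s) ξ =
      s⁻¹ ^ k • iteratedFDeriv ℝ k (fun ξ => ((ψ ξ : ℝ) : ℂ)) (s⁻¹ • ξ) :=
    congrFun (iteratedFDeriv_comp_const_smul (i := k) s⁻¹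
      (hsm.of_le (by exact_mod_cast le_top))) ξ
  rw [e, norm_smul, norm_pow]
  have h' := h k hk (s⁻¹ • ξ)
  rw [mul_one] at h'
  exact (mul_le_of_le_one_left (norm_nonneg _) (pow_le_one₀ (norm_nonneg _) hs')).trans h'

/-- The amplitude of `K_j(x,·) - K_j(z,·)`, with phases centred at `x₀`. -/
def diffAmp {n : ℕ} (a : Rn n → Rn n → ℂ) (ψ : Rn n → ℝ) (s : ℝ) (x₀ x z ξ : Rn n) : ℂ :=
  expChar (z - x₀) ξ * ((expChar (x - z) ξ - 1) * a x ξ + (a x ξ - a z ξ)) * dilCut ψ s ξ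

theorem HormClass.contDiff_right {n : ℕ} {m ϱ δ : ℝ} {a : Rn n → Rn n → ℂ}
    (ha : HormClass m ϱ δ a) (x : Rn n) : ContDiff ℝ (⊤ : ℕ∞) (a x) :=
  ha.1.comp (contDiff_const.prodMk contDiff_id)

theorem contDiff_diffAmp {n : ℕ} {a : Rn n → Rn n → ℂ} {ψ : Rn n → ℝ}
    (ha : ∀ x, ContDiff ℝ (⊤ : ℕ∞) (a x)) (hψ : ContDiff ℝ (⊤ : ℕ∞) ψ) (s : ℝ) (x₀ x z : Rn n) :
    ContDiff ℝ (⊤ : ℕ∞) (diffAmp a ψ s x₀ x z) :=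
  ((contDiff_expChar _).mul ((((contDiff_expChar _).sub contDiff_const).mul (ha x)).add
    ((ha x).sub (ha z)))).mul (contDiff_dilCut hψ s)

theorem tsupport_diffAmp_subset {n : ℕ} (a : Rn n → Rn n → ℂ) (ψ : Rn n → ℝ) (s : ℝ)
    (x₀ x z : Rn n) : tsupport (diffAmp a ψ s x₀ x z) ⊆ tsupport (dilCut ψ s) :=
  tsupport_mul_subset_right

theorem exists_norm_iteratedFDeriv_diffAmp_le {n : ℕ} (hn : 1 ≤ n) {δ : ℝ} (hδ1 : δ ≤ 1)
    {a : Rn n → Rn n → ℂ} (ha : HormClass (-(n : ℝ)) 0 δ a) {C₀ : ℝ} (hC₀ : 1 < C₀)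
    {ψ : Rn n → ℝ} (hψ : LPcut C₀ ψ) (N : ℕ) :
    ∃ C : ℝ, 0 < C ∧ ∀ l s : ℝ, 0 < l → l < 1 → 1 ≤ s → ∀ x₀ : Rn n, ∀ x ∈ cube x₀ l,
      ∀ z ∈ cube x₀ l, ∀ ξ, ∀ k ≤ N,
        ‖iteratedFDeriv ℝ k (diffAmp a ψ s x₀ x z) ξ‖ ≤ C * (s * l) * (s ^ n)⁻¹ := by
  obtain ⟨M, hM, hMb⟩ := ha.exists_bound hδ1 hC₀ N
  obtain ⟨D, hD, hDb⟩ := hψ.exists_bound N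
  have hn' : (1 : ℝ) ≤ n := by exact_mod_cast hn
  have hn0 : (0 : ℝ) < n := by linarith
  set T : ℝ := (2 * n) ^ (N + 1) * (2 * C₀) with hT
  have hT0 : 0 < T := by positivity
  refine ⟨2 ^ N * (2 ^ N * (n ^ N * (2 ^ N * (T * M) + 2 * n * M)) * D), by positivity, ?_⟩
  intro l s hl hl1 hs x₀ x hx z hz ξ k hk
  have hs0 : 0 < s := by linarith
  by_cases hξ : ξ ∈ tsupport (dilCut ψ s)
  swap
  · have h0 : iteratedFDeriv ℝ k (diffAmp a ψ s x₀ x z) ξ = 0 := by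
      by_contra h
      exact hξ (tsupport_diffAmp_subset a ψ s x₀ x z (support_iteratedFDeriv_subset k h))
    rw [h0, norm_zero]
    positivity
  obtain ⟨hξ1, hξ2⟩ := hψ.mem_annulus hs0 hξ
  have hzx : ‖z - x₀‖ ≤ n :=
    (norm_sub_le_of_mem_cube hl.le hz).trans (mul_le_of_le_one_right hn0.le hl1.le)
  have hxz : ‖x - z‖ ≤ 2 * n * l := by
    have := norm_sub_le (x - x₀) (z - x₀)
    rw [sub_sub_sub_cancel_right] at this
    linarith [norm_sub_le_of_mem_cube hl.le hx, norm_sub_le_of_mem_cube hl.le hz]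
  have hsm := ha.contDiff_right
  have hE : ContDiff ℝ (⊤ : ℕ∞) fun ξ => expChar (x - z) ξ - 1 :=
    (contDiff_expChar _).sub contDiff_const
  have b1 : ∀ k ≤ N, ‖iteratedFDeriv ℝ k (expChar (z - x₀)) ξ‖ ≤ n ^ N := fun k hk =>
    (norm_iteratedFDeriv_expChar_le _ _ _).trans
      ((pow_le_pow_left₀ (norm_nonneg _) hzx k).trans (pow_le_pow_right₀ hn' hk))
  have b2 : ∀ k ≤ N, ‖iteratedFDeriv ℝ k (fun ξ => expChar (x - z) ξ - 1) ξ‖ ≤ T * (s * l) := by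
    intro k hk
    refine (norm_iteratedFDeriv_expChar_sub_one_le _ _ _).trans ?_
    split_ifs with hk0
    · calc ‖x - z‖ * ‖ξ‖ ≤ (2 * n * l) * (2 * C₀ * s) := by gcongr
        _ = (2 * n) ^ 1 * (2 * C₀) * (s * l) := by ring
        _ ≤ T * (s * l) := by
            rw [hT]
            gcongr
            · linarith
            · omega
    · calc ‖x - z‖ ^ k ≤ (2 * n * l) ^ k := by gcongr
        _ = (2 * n) ^ k * l ^ k := mul_pow _ _ _
        _ ≤ (2 * n) ^ (N + 1) * l := by
            gcongr
            · linarith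
            · omega
            · exact pow_le_of_le_one hl.le hl1.le hk0
        _ ≤ T * (s * l) := by
            rw [hT, mul_assoc]
            gcongr
            have : 1 ≤ 2 * C₀ * s := by nlinarith
            nlinarith
  have b3 : ∀ k ≤ N, ‖iteratedFDeriv ℝ k
      (fun ξ => (expChar (x - z) ξ - 1) * a x ξ + (a x ξ - a z ξ)) ξ‖ ≤
      (2 ^ N * (T * M) + 2 * n * M) * (s * l) * (s ^ n)⁻¹ := by
    intro k hk
    have h1 := norm_iteratedFDeriv_mul_le_of_le hE (hsm x) b2
      (fun k hk => (hMb s hs ξ hξ1 hξ2 k hk x z).1) k hk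
    have h2 := (hMb s hs ξ hξ1 hξ2 k hk x z).2
    rw [fun_iteratedFDeriv_add_apply
      ((hE.mul (hsm x)).of_le (by exact_mod_cast le_top)).contDiffAt
      (((hsm x).sub (hsm z)).of_le (by exact_mod_cast le_top)).contDiffAt]
    calc _ ≤ 2 ^ N * (T * (s * l) * (M * (s ^ n)⁻¹)) + M * (s ^ n)⁻¹ * (s * ‖x - z‖) :=
          (norm_add_le _ _).trans (add_le_add h1 h2)
      _ ≤ 2 ^ N * (T * (s * l) * (M * (s ^ n)⁻¹)) + M * (s ^ n)⁻¹ * (s * (2 * n * l)) := by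
          gcongr
      _ = _ := by ring
  have hF : ContDiff ℝ (⊤ : ℕ∞) fun ξ => (expChar (x - z) ξ - 1) * a x ξ + (a x ξ - a z ξ) :=
    (hE.mul (hsm x)).add ((hsm x).sub (hsm z))
  have b4 := norm_iteratedFDeriv_mul_le_of_le (contDiff_expChar (z - x₀)) hF b1 b3
  have b5 := norm_iteratedFDeriv_mul_le_of_le ((contDiff_expChar (z - x₀)).mul hF)
    (contDiff_dilCut hψ.1 s) b4 (fun k hk => hDb s hs k hk ξ) k hk
  refine b5.trans (le_of_eq ?_)
  ring

theorem Kj_sub_Kj_eq {n : ℕ} {a : Rn n → Rn n → ℂ} (ha : ∀ x, Continuous (a x)) {C₀ : ℝ}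
    {ψ : Rn n → ℝ} (hψ : LPcut C₀ ψ) (j : ℕ) (x₀ x z y : Rn n) :
    Kj a ψ j x y - Kj a ψ j z y = ((((2 * π) ^ n)⁻¹ : ℝ) : ℂ) *
      ∫ ξ, expChar (x₀ - y) ξ * diffAmp a ψ (2 ^ j) x₀ x z ξ := by
  have hcs : HasCompactSupport (dilCut ψ (2 ^ j)) :=
    (isCompact_closedBall (0 : Rn n) (2 * C₀ * 2 ^ j)).of_isClosed_subset (isClosed_tsupport _)
      fun ξ hξ => by simpa using (hψ.mem_annulus (by positivity) hξ).2
  have hint : ∀ w, Integrable fun ξ => expChar (w - y) ξ * a w ξ * dilCut ψ (2 ^ j) ξ := fun w =>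
    (((contDiff_expChar _).continuous.mul (ha w)).mul
      (contDiff_dilCut hψ.1 _).continuous).integrable_of_hasCompactSupport hcs.mul_left
  have hK : ∀ w, Kj a ψ j w y = ((((2 * π) ^ n)⁻¹ : ℝ) : ℂ) *
      ∫ ξ, expChar (w - y) ξ * a w ξ * dilCut ψ (2 ^ j) ξ := fun w => rfl
  rw [hK, hK, ← mul_sub, ← integral_sub (hint x) (hint z)]
  congr 1
  refine integral_congr_ae (Filter.Eventually.of_forall fun ξ => ?_)
  have e1 : x - y = (x₀ - y) + ((z - x₀) + (x - z)) := by abel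
  have e2 : z - y = (x₀ - y) + (z - x₀) := by abel
  simp only [diffAmp]
  rw [e1, e2, expChar_add, expChar_add, expChar_add]
  ring

/-- If `a ∈ S^{-n}_{0,δ}` with `0 ≤ δ < 1`, then for `0 < l < 1`, `j ≥ 1`, and
`x, z ∈ Q(x₀, l)`: `∫ |u(y)| |K_j(x,y) - K_j(z,y)| dy ≤ C 2^j l Mu(x₀)`. -/
theorem stmt8 (n : ℕ) (hn : 1 ≤ n) (δ : ℝ) (hδ0 : 0 ≤ δ) (hδ1 : δ < 1)
    (a : Rn n → Rn n → ℂ) (ha : HormClass (-(n : ℝ)) 0 δ a)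
    (C₀ : ℝ) (hC₀ : 1 < C₀) (ψ : Rn n → ℝ) (hψ : LPcut C₀ ψ) :
    ∃ C : ℝ, 0 < C ∧ ∀ l : ℝ, 0 < l → l < 1 → ∀ j : ℕ, 1 ≤ j → ∀ x₀ : Rn n,
      ∀ u : SchwartzMap (Rn n) ℂ, ∀ x ∈ cube x₀ l, ∀ z ∈ cube x₀ l,
        (∫⁻ y : Rn n, (‖u y‖₊ : ℝ≥0∞) * (‖Kj a ψ j x y - Kj a ψ j z y‖₊ : ℝ≥0∞)) ≤
          ENNReal.ofReal (C * 2 ^ j * l) * mHL (⇑u) x₀ := by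
  obtain ⟨C₁, hC₁, hF⟩ := exists_pow_mul_norm_integral_expChar_le n (n + 1)
  obtain ⟨C₂, hC₂, hA⟩ := exists_norm_iteratedFDeriv_diffAmp_le hn hδ1.le ha hC₀ hψ (n + 1)
  refine ⟨2 ^ (2 * n + 2) * (C₁ * (C₂ * (2 * C₀) ^ n)), by positivity, ?_⟩
  intro l hl hl1 j _ x₀ u x hx z hz
  have hs : (1 : ℝ) ≤ 2 ^ j := one_le_pow₀ one_le_two
  have hker : ∀ y, ∀ k ≤ n + 1, ‖x₀ - y‖ ^ k * ‖Kj a ψ j x y - Kj a ψ j z y‖ ≤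
      C₁ * (C₂ * (2 * C₀) ^ n) * 2 ^ j * l := by
    intro y k hk
    have h := hF (diffAmp a ψ (2 ^ j) x₀ x z) (2 * C₀ * 2 ^ j)
      (C₂ * (2 ^ j * l) * ((2 ^ j) ^ n)⁻¹) (by positivity) (by positivity)
      (contDiff_diffAmp ha.contDiff_right hψ.1 _ _ _ _)
      (fun ξ hξ => by
        simpa using (hψ.mem_annulus (by positivity) (tsupport_diffAmp_subset _ _ _ _ _ _ hξ)).2)
      (fun ξ k hk => hA l (2 ^ j) hl hl1 hs x₀ x hx z hz ξ k hk) (x₀ - y) k hk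
    have hc : ‖((((2 * π) ^ n)⁻¹ : ℝ) : ℂ)‖ ≤ 1 := by
      rw [Complex.norm_real, Real.norm_of_nonneg (by positivity)]
      exact inv_le_one_of_one_le₀ (one_le_pow₀ (by linarith [Real.pi_gt_three]))
    rw [Kj_sub_Kj_eq (fun w => (ha.contDiff_right w).continuous) hψ j x₀, norm_mul]
    calc _ ≤ ‖x₀ - y‖ ^ k * (1 * ‖∫ ξ, expChar (x₀ - y) ξ * diffAmp a ψ (2 ^ j) x₀ x z ξ‖) := by
          gcongr
      _ ≤ C₁ * (C₂ * (2 ^ j * l) * ((2 ^ j) ^ n)⁻¹ * (2 * C₀ * 2 ^ j) ^ n) := by rwa [one_mul]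
      _ = _ := by
          rw [mul_pow (2 * C₀)]
          field_simp
  have hmain := lintegral_mul_le_mHL (k := fun y => Kj a ψ j x y - Kj a ψ j z y) u.continuous x₀
    (B := C₁ * (C₂ * (2 * C₀) ^ n) * 2 ^ j * l) (by positivity)
    (fun y => by simpa using hker y 0 (Nat.zero_le _)) (fun y => hker y (n + 1) le_rfl)
  refine hmain.trans (le_of_eq ?_)
  congr 2
  ring
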